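/- Fix an integer N ≥ 2 and let μ be a non-atomic Borel probability measure on [0,1] such that F_{N,0}(x) := μ([0,x]) is twice continuously differentiable on [0,1]. Then for every x ∈ [0,1], lim_{n→∞} F_{N,n}(x) = ρ_N([0,x]), where ρ_N is the probability measure on [0,1] with density 1/(log(N/(N−1))·(x+N−1)) with respect to Lebesgue measure. -/

import Mathlib

open MeasureTheory Set Filter

/-- The Rényi-type continued fraction transformation
`R_N(x) = N/(1-x) - ⌊N/(1-x)⌋` for `x ≠ 1`, and `R_N(1) = 0`. -/
noncomputable def renyiMap (N : ℕ) (x : ℝ) : ℝ :=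
  if x = 1 then 0 else Int.fract ((N : ℝ) / (1 - x))

/-- `F_{N,n}(x) = μ {y ∈ [0,1] : R_N^n(y) ≤ x}`. -/
noncomputable def Fdist (N : ℕ) (μ : Measure ℝ) (n : ℕ) (x : ℝ) : ℝ :=
  (μ {y ∈ Icc (0 : ℝ) 1 | (renyiMap N)^[n] y ≤ x}).toReal

/-- The inverse branch of `renyiMap N` onto the cylinder where `⌊N / (1 - y)⌋ = N + k`. -/
noncomputable def renyiBranch (N k : ℕ) (x : ℝ) : ℝ := 1 - N / (x + N + k)

/-- The transition probability from `x` to `renyiBranch N k x`. -/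
noncomputable def renyiWeight (N k : ℕ) (x : ℝ) : ℝ :=
  (x + N - 1) / ((x + N + k - 1) * (x + N + k))

/-- The tail `∑_{j ≥ k} renyiWeight N j x`, in closed form. -/
noncomputable def renyiTail (N k : ℕ) (x : ℝ) : ℝ := (x + N - 1) / (x + N + k - 1)

/-- The transfer operator of `renyiMap N`, normalised by its invariant density. -/
noncomputable def renyiTransfer (N : ℕ) (f : ℝ → ℝ) (x : ℝ) : ℝ :=
  ∑' k, renyiWeight N k x * f (renyiBranch N k x)

section Branches

variable {N : ℕ}

lemma renyiBranch_mem (k : ℕ) {x : ℝ} (hx : x ∈ Icc (0 : ℝ) 1) :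
    renyiBranch N k x ∈ Icc (0 : ℝ) 1 := by
  have hk : (0 : ℝ) ≤ k := k.cast_nonneg
  have hN : (0 : ℝ) ≤ N := N.cast_nonneg
  have hd : 0 ≤ x + N + k := by linarith [hx.1]
  refine ⟨?_, ?_⟩
  · have : (N : ℝ) / (x + N + k) ≤ 1 := div_le_one_of_le₀ (by linarith [hx.1]) hd
    unfold renyiBranch; linarith
  · have : 0 ≤ (N : ℝ) / (x + N + k) := by positivity
    unfold renyiBranch; linarith

lemma renyiWeight_nonneg (hN : 2 ≤ N) (k : ℕ) {x : ℝ} (hx : x ∈ Icc (0 : ℝ) 1) :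
    0 ≤ renyiWeight N k x := by
  have hk : (0 : ℝ) ≤ k := k.cast_nonneg
  have hN' : (2 : ℝ) ≤ N := by exact_mod_cast hN
  have := hx.1
  exact div_nonneg (by linarith) (mul_nonneg (by linarith) (by linarith))

lemma renyiWeight_eq_sub (hN : 2 ≤ N) (k : ℕ) {x : ℝ} (hx : x ∈ Icc (0 : ℝ) 1) :
    renyiWeight N k x = renyiTail N k x - renyiTail N (k + 1) x := by
  have hk : (0 : ℝ) ≤ k := k.cast_nonneg
  have hN' : (2 : ℝ) ≤ N := by exact_mod_cast hN
  have := hx.1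
  have h1 : x + N + k - 1 ≠ 0 := by linarith
  have h2 : x + N + k ≠ 0 := by linarith
  have h3 : x + N + ((k + 1 : ℕ) : ℝ) - 1 = x + N + k := by push_cast; ring
  unfold renyiWeight renyiTail
  rw [h3]
  field_simp
  ring

lemma renyiWeight_div_le (hN : 2 ≤ N) (k : ℕ) {x : ℝ} (hx : x ∈ Icc (0 : ℝ) 1) :
    renyiWeight N k x / (x + N - 1) ≤ 1 / ((k : ℝ) + 1) ^ 2 := by
  have hk : (0 : ℝ) ≤ k := k.cast_nonneg
  have hN' : (2 : ℝ) ≤ N := by exact_mod_cast hN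
  have := hx.1
  have h1 : x + N - 1 ≠ 0 := by linarith
  have : renyiWeight N k x / (x + N - 1) = 1 / ((x + N + k - 1) * (x + N + k)) := by
    have h2 : x + N + k - 1 ≠ 0 := by linarith
    have h3 : x + N + k ≠ 0 := by linarith
    unfold renyiWeight
    field_simp
  rw [this]
  apply one_div_le_one_div_of_le (by positivity)
  nlinarith

lemma summable_one_div_succ_sq : Summable fun k : ℕ => 1 / ((k : ℝ) + 1) ^ 2 := by
  have := (summable_nat_add_iff 1).2 (Real.summable_one_div_nat_pow.2 one_lt_two)
  simpa using this

lemma summable_renyiWeight_mul (hN : 2 ≤ N) {f : ℝ → ℝ} {M : ℝ}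
    (hM : ∀ x ∈ Icc (0 : ℝ) 1, |f x| ≤ M) {x : ℝ} (hx : x ∈ Icc (0 : ℝ) 1) :
    Summable fun k => renyiWeight N k x * f (renyiBranch N k x) := by
  have hN' : (2 : ℝ) ≤ N := by exact_mod_cast hN
  have hpos : 0 < x + N - 1 := by linarith [hx.1]
  refine Summable.of_norm_bounded
    (summable_one_div_succ_sq.mul_left ((x + N - 1) * M)) fun k => ?_
  have h := renyiWeight_div_le hN k hx
  rw [div_le_iff₀ hpos] at h
  have hf := hM _ (renyiBranch_mem (N := N) k hx)
  rw [Real.norm_eq_abs, abs_mul, abs_of_nonneg (renyiWeight_nonneg hN k hx)]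
  calc _ ≤ (1 / ((k : ℝ) + 1) ^ 2 * (x + N - 1)) * M :=
        mul_le_mul h hf (abs_nonneg _) (by positivity)
    _ = _ := by ring

lemma tendsto_renyiTail (x : ℝ) : Tendsto (fun k => renyiTail N k x) atTop (nhds 0) := by
  refine Tendsto.const_div_atTop ?_ _
  have : Tendsto (fun k : ℕ => (x + N - 1) + (k : ℝ)) atTop atTop :=
    tendsto_atTop_add_const_left _ _ tendsto_natCast_atTop_atTop
  exact this.congr fun k => by ring

lemma renyiBranch_sub_abs_le (hN : 2 ≤ N) (k : ℕ) {x y : ℝ}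
    (hx : x ∈ Icc (0 : ℝ) 1) (hy : y ∈ Icc (0 : ℝ) 1) :
    |renyiBranch N k x - renyiBranch N k y| ≤ 1 / N * |x - y| := by
  have hk : (0 : ℝ) ≤ k := k.cast_nonneg
  have hN' : (2 : ℝ) ≤ N := by exact_mod_cast hN
  have hx0 := hx.1
  have hy0 := hy.1
  have h1 : 0 < x + N + k := by linarith
  have h2 : 0 < y + N + k := by linarith
  have h : renyiBranch N k x - renyiBranch N k y
      = N / ((x + N + k) * (y + N + k)) * (x - y) := by
    unfold renyiBranch; field_simp; ring
  rw [h, abs_mul, abs_of_nonneg (by positivity)]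
  refine mul_le_mul_of_nonneg_right ?_ (abs_nonneg _)
  rw [div_le_div_iff₀ (by positivity) (by positivity)]
  nlinarith [mul_nonneg hx0 hy0, mul_nonneg hx0 hk, mul_nonneg hk hy0]

lemma renyiTail_mul_branch_gap_le (hN : 2 ≤ N) (k : ℕ) {x y : ℝ}
    (hx : x ∈ Icc (0 : ℝ) 1) (hy : y ∈ Icc (0 : ℝ) 1) :
    |renyiTail N (k + 1) x - renyiTail N (k + 1) y|
        * |renyiBranch N (k + 1) y - renyiBranch N k y|
      ≤ 9 / 16 * (1 / (N + k) - 1 / (N + k + 1)) * |x - y| := by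
  have hk : (0 : ℝ) ≤ k := k.cast_nonneg
  have hN' : (2 : ℝ) ≤ N := by exact_mod_cast hN
  have hx0 := hx.1
  have hy0 := hy.1
  have h1 : 0 < x + N + k := by linarith
  have h2 : 0 < y + N + k := by linarith
  have h3 : x + N + ((k + 1 : ℕ) : ℝ) - 1 = x + N + k := by push_cast; ring
  have h4 : y + N + ((k + 1 : ℕ) : ℝ) - 1 = y + N + k := by push_cast; ring
  have h5 : y + N + ((k + 1 : ℕ) : ℝ) = y + N + k + 1 := by push_cast; ring
  have hd : renyiTail N (k + 1) x - renyiTail N (k + 1) y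
      = (k + 1) / ((x + N + k) * (y + N + k)) * (x - y) := by
    unfold renyiTail
    rw [h3, h4]; field_simp; ring
  have hb : renyiBranch N (k + 1) y - renyiBranch N k y
      = N / ((y + N + k) * (y + N + k + 1)) := by
    unfold renyiBranch
    rw [h5]; field_simp; ring
  rw [hd, hb, abs_mul, abs_of_nonneg (by positivity : 0 ≤ (k + 1) / ((x + N + k) * (y + N + k))),
    abs_of_nonneg (by positivity : 0 ≤ N / ((y + N + k) * (y + N + k + 1)))]
  have hA : (k + 1) / ((x + N + k) * (y + N + k)) ≤ (k + 1) / ((N + k : ℝ) * (N + k)) := by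
    gcongr <;> linarith
  have hB : (N : ℝ) / ((y + N + k) * (y + N + k + 1)) ≤ N / ((N + k) * (N + k + 1)) := by
    gcongr <;> linarith
  have hC : (k + 1) / ((N + k : ℝ) * (N + k)) * (N / ((N + k) * (N + k + 1)))
      ≤ 9 / 16 * (1 / (N + k) - 1 / (N + k + 1)) := by
    have e1 : (9 / 16 * (1 / (N + k) - 1 / (N + k + 1)) : ℝ)
        = (9 / 16) * (1 / ((N + k) * (N + k + 1))) := by field_simp; ring
    have e2 : (k + 1) / ((N + k : ℝ) * (N + k)) * (N / ((N + k) * (N + k + 1)))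
        = ((k + 1) * N / ((N + k) * (N + k))) * (1 / ((N + k) * (N + k + 1))) := by
      field_simp
    rw [e1, e2]
    refine mul_le_mul_of_nonneg_right ?_ (by positivity)
    rw [div_le_div_iff₀ (by positivity) (by norm_num)]
    nlinarith [sq_nonneg ((k : ℝ) + 1 - N), mul_nonneg hk hk]
  calc _ = ((k + 1) / ((x + N + k) * (y + N + k)) * (N / ((y + N + k) * (y + N + k + 1))))
          * |x - y| := by ring
    _ ≤ ((k + 1) / ((N + k : ℝ) * (N + k)) * (N / ((N + k) * (N + k + 1)))) * |x - y| := by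
        gcongr
    _ ≤ _ := by gcongr

lemma renyiTransfer_partial_sum_le (hN : 2 ≤ N) {f : ℝ → ℝ} {L : ℝ}
    (hf : ∀ x ∈ Icc (0 : ℝ) 1, ∀ y ∈ Icc (0 : ℝ) 1, |f x - f y| ≤ L * |x - y|) (hL : 0 ≤ L)
    {x y : ℝ} (hx : x ∈ Icc (0 : ℝ) 1) (hy : y ∈ Icc (0 : ℝ) 1) (n : ℕ) :
    |∑ k ∈ Finset.range n, (renyiWeight N k x * f (renyiBranch N k x)
          - renyiWeight N k y * f (renyiBranch N k y))
        + (renyiTail N n x - renyiTail N n y) * f (renyiBranch N n y)|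
      ≤ L * |x - y| * (1 / N * (1 - renyiTail N n x)
          + 9 / 16 * (1 / N - 1 / (N + n))) := by
  have hN' : (2 : ℝ) ≤ N := by exact_mod_cast hN
  induction n with
  | zero =>
    have h1 : x + N - 1 ≠ 0 := by linarith [hx.1]
    have h2 : y + N - 1 ≠ 0 := by linarith [hy.1]
    simp [renyiTail, h1, h2]
  | succ n ih =>
    have hbx := renyiBranch_mem (N := N) n hx
    have hby := renyiBranch_mem (N := N) n hy
    have hby' := renyiBranch_mem (N := N) (n + 1) hy
    have hw := renyiWeight_nonneg hN n hx
    have hA : |renyiWeight N n x * (f (renyiBranch N n x) - f (renyiBranch N n y))|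
        ≤ L * |x - y| * (1 / N * renyiWeight N n x) := by
      rw [abs_mul, abs_of_nonneg hw]
      calc _ ≤ renyiWeight N n x * (L * (1 / N * |x - y|)) := by
            gcongr
            exact (hf _ hbx _ hby).trans
              (mul_le_mul_of_nonneg_left (renyiBranch_sub_abs_le hN n hx hy) hL)
        _ = _ := by ring
    have hB : |(renyiTail N (n + 1) x - renyiTail N (n + 1) y)
          * (f (renyiBranch N (n + 1) y) - f (renyiBranch N n y))|
        ≤ L * |x - y| * (9 / 16 * (1 / (N + n) - 1 / (N + n + 1))) := by
      rw [abs_mul]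
      calc _ ≤ |renyiTail N (n + 1) x - renyiTail N (n + 1) y|
              * (L * |renyiBranch N (n + 1) y - renyiBranch N n y|) := by
            gcongr
            exact hf _ hby' _ hby
        _ = L * (|renyiTail N (n + 1) x - renyiTail N (n + 1) y|
              * |renyiBranch N (n + 1) y - renyiBranch N n y|) := by ring
        _ ≤ L * (9 / 16 * (1 / (N + n) - 1 / (N + n + 1)) * |x - y|) :=
            mul_le_mul_of_nonneg_left (renyiTail_mul_branch_gap_le hN n hx hy) hL
        _ = _ := by ring
    have hsum := (abs_add_three _ _ _).trans (add_le_add (add_le_add ih hA) hB)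
    have hwx := renyiWeight_eq_sub hN n hx
    have hwy := renyiWeight_eq_sub hN n hy
    rw [Finset.sum_range_succ]
    refine le_trans (le_of_eq ?_) (hsum.trans (le_of_eq ?_))
    · congr 1
      rw [hwx, hwy]; ring
    · rw [hwx]; push_cast; ring

lemma abs_le_of_lipschitz_Icc {f : ℝ → ℝ} {L : ℝ} (hL : 0 ≤ L)
    (hf : ∀ x ∈ Icc (0 : ℝ) 1, ∀ y ∈ Icc (0 : ℝ) 1, |f x - f y| ≤ L * |x - y|) :
    ∀ x ∈ Icc (0 : ℝ) 1, |f x| ≤ |f 0| + L := by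
  intro x hx
  have h := hf x hx 0 ⟨le_rfl, zero_le_one⟩
  rw [sub_zero, abs_of_nonneg hx.1] at h
  have h2 : |f x| - |f 0| ≤ |f x - f 0| := abs_sub_abs_le_abs_sub _ _
  nlinarith [hx.2]

/-- The transfer operator contracts Lipschitz constants on `[0, 1]`. -/
lemma renyiTransfer_lipschitz (hN : 2 ≤ N) {f : ℝ → ℝ} {L : ℝ} (hL : 0 ≤ L)
    (hf : ∀ x ∈ Icc (0 : ℝ) 1, ∀ y ∈ Icc (0 : ℝ) 1, |f x - f y| ≤ L * |x - y|)
    {x y : ℝ} (hx : x ∈ Icc (0 : ℝ) 1) (hy : y ∈ Icc (0 : ℝ) 1) :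
    |renyiTransfer N f x - renyiTransfer N f y| ≤ 25 / 32 * L * |x - y| := by
  have hN' : (2 : ℝ) ≤ N := by exact_mod_cast hN
  have hM := abs_le_of_lipschitz_Icc hL hf
  have hs : Tendsto (fun n => ∑ k ∈ Finset.range n, (renyiWeight N k x * f (renyiBranch N k x)
          - renyiWeight N k y * f (renyiBranch N k y))) atTop
      (nhds (renyiTransfer N f x - renyiTransfer N f y)) :=
    ((summable_renyiWeight_mul hN hM hx).hasSum.sub
      (summable_renyiWeight_mul hN hM hy).hasSum).tendsto_sum_nat
  have hd : Tendsto (fun n => (renyiTail N n x - renyiTail N n y) * f (renyiBranch N n y))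
      atTop (nhds 0) := by
    have h0 : Tendsto (fun n => |renyiTail N n x - renyiTail N n y| * (|f 0| + L))
        atTop (nhds 0) := by
      simpa using (((tendsto_renyiTail x).sub (tendsto_renyiTail y)).abs).mul_const (|f 0| + L)
    refine squeeze_zero_norm (fun n => ?_) h0
    rw [Real.norm_eq_abs, abs_mul]
    exact mul_le_mul_of_nonneg_left (hM _ (renyiBranch_mem n hy)) (abs_nonneg _)
  have ht := (hs.add hd).abs
  rw [add_zero] at ht
  refine le_of_tendsto' ht fun n => (renyiTransfer_partial_sum_le hN hf hL hx hy n).trans ?_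
  have h1 : 0 ≤ renyiTail N n x := by
    have hn : (0 : ℝ) ≤ n := n.cast_nonneg
    exact div_nonneg (by linarith [hx.1]) (by linarith [hx.1])
  have h2 : (1 : ℝ) / N ≤ 1 / 2 := one_div_le_one_div_of_le (by norm_num) hN'
  have h3 : 0 ≤ (1 : ℝ) / (N + n) := by positivity
  have h4 : (1 : ℝ) / N * (1 - renyiTail N n x) ≤ 1 / N :=
    mul_le_of_le_one_right (by positivity) (by linarith)
  calc _ ≤ L * |x - y| * (25 / 32) := by
        gcongr
        linarith
    _ = _ := by ring

end Branches

section Distribution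

variable {N : ℕ}

lemma measurable_renyiMap (N : ℕ) : Measurable (renyiMap N) :=
  Measurable.ite (measurableSet_singleton 1) measurable_const
    (measurable_fract.comp (measurable_const.div (measurable_const.sub measurable_id)))

lemma renyiMap_mem_Icc (N : ℕ) (x : ℝ) : renyiMap N x ∈ Icc (0 : ℝ) 1 := by
  unfold renyiMap
  split_ifs
  · exact ⟨le_rfl, zero_le_one⟩
  · exact ⟨Int.fract_nonneg _, (Int.fract_lt_one _).le⟩

lemma countable_renyiMap_preimage_singleton (hN : 2 ≤ N) (c : ℝ) :
    (renyiMap N ⁻¹' {c}).Countable := by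
  have hN' : (2 : ℝ) ≤ N := by exact_mod_cast hN
  refine ((countable_range fun m : ℤ => 1 - (N : ℝ) / (m + c)).union
    (countable_singleton (1 : ℝ))).mono fun y hy => ?_
  by_cases h1 : y = 1
  · exact Or.inr h1
  refine Or.inl ⟨⌊(N : ℝ) / (1 - y)⌋, ?_⟩
  have hy' : Int.fract ((N : ℝ) / (1 - y)) = c := by
    simpa [renyiMap, h1] using hy
  have h2 : 1 - y ≠ 0 := sub_ne_zero.2 (Ne.symm h1)
  have h3 : (⌊(N : ℝ) / (1 - y)⌋ : ℝ) + c = N / (1 - y) := by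
    rw [← hy']; exact Int.floor_add_fract _
  simp only [h3]
  field_simp
  ring

lemma nullSingletonClass_map_renyiMap (hN : 2 ≤ N) (ν : Measure ℝ) [NullSingletonClass ν] :
    NullSingletonClass (ν.map (renyiMap N)) where
  measure_singleton c := by
    rw [Measure.map_apply (measurable_renyiMap N) (measurableSet_singleton c)]
    exact (countable_renyiMap_preimage_singleton hN c).measure_zero ν

lemma renyiBranch_mono (hN : 2 ≤ N) (k : ℕ) {x y : ℝ} (hx : 0 ≤ x) (hxy : x ≤ y) :
    renyiBranch N k x ≤ renyiBranch N k y := by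
  have hk : (0 : ℝ) ≤ k := k.cast_nonneg
  have hN' : (2 : ℝ) ≤ N := by exact_mod_cast hN
  unfold renyiBranch
  gcongr

lemma renyiBranch_lt_iff (k : ℕ) (hN : 2 ≤ N) {x y : ℝ} (hx : 0 ≤ x) (hy : y < 1) :
    renyiBranch N k x < y ↔ x + N + k < N / (1 - y) := by
  have hk : (0 : ℝ) ≤ k := k.cast_nonneg
  have hN' : (2 : ℝ) ≤ N := by exact_mod_cast hN
  unfold renyiBranch
  rw [lt_div_iff₀ (by linarith), sub_lt_comm, lt_div_iff₀ (by linarith), mul_comm]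

lemma renyiMap_le_iff (hN : 2 ≤ N) {x y : ℝ} (hx : x ∈ Icc (0 : ℝ) 1) (hy : y ∈ Icc (0 : ℝ) 1)
    (hy1 : y ≠ 1) (hyb : ∀ k, y ≠ renyiBranch N k 0) :
    renyiMap N y ≤ x ↔ ∃ k, y ∈ Ioc (renyiBranch N k 0) (renyiBranch N k x) := by
  have hN' : (2 : ℝ) ≤ N := by exact_mod_cast hN
  have hlt : y < 1 := lt_of_le_of_ne hy.2 hy1
  have hpos : 0 < 1 - y := by linarith
  have hge : (N : ℝ) ≤ N / (1 - y) := by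
    rw [le_div_iff₀ hpos]; nlinarith [hy.1]
  have key : ∀ k, y ∈ Ioc (renyiBranch N k 0) (renyiBranch N k x) ↔
      (N : ℝ) + k < N / (1 - y) ∧ N / (1 - y) ≤ x + N + k := by
    intro k
    rw [mem_Ioc, renyiBranch_lt_iff k hN le_rfl hlt, zero_add, ← not_lt (b := y),
      ← not_lt (b := (N : ℝ) / (1 - y))]
    refine and_congr_right fun _ => not_congr ?_
    exact renyiBranch_lt_iff k hN hx.1 hlt
  simp only [key]
  have hne : ∀ k : ℕ, (N : ℝ) / (1 - y) ≠ N + k := by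
    intro k h
    have hk : (0 : ℝ) ≤ k := k.cast_nonneg
    apply hyb k
    unfold renyiBranch
    rw [zero_add, ← h]
    field_simp
    ring
  have hR : renyiMap N y = Int.fract ((N : ℝ) / (1 - y)) := by simp [renyiMap, hy1]
  rw [hR]
  constructor
  · intro h
    have hfl : (N : ℤ) ≤ ⌊(N : ℝ) / (1 - y)⌋ := Int.le_floor.2 (by exact_mod_cast hge)
    obtain ⟨k, hk⟩ := Int.le.dest hfl
    have hk' : (⌊(N : ℝ) / (1 - y)⌋ : ℝ) = N + k := by rw [← hk]; push_cast; ring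
    refine ⟨k, lt_of_le_of_ne ?_ (hne k).symm, ?_⟩
    · rw [← hk']; exact Int.floor_le _
    · have := Int.floor_add_fract ((N : ℝ) / (1 - y))
      linarith
  · rintro ⟨k, h1, h2⟩
    have h3 : (N : ℝ) / (1 - y) < N + k + 1 := by
      refine lt_of_le_of_ne (by linarith [hx.2]) ?_
      have := hne (k + 1)
      push_cast at this
      rwa [← add_assoc] at this
    have hfl : ⌊(N : ℝ) / (1 - y)⌋ = (N : ℤ) + k := by
      rw [Int.floor_eq_iff]; push_cast; exact ⟨h1.le, h3⟩
    have := Int.floor_add_fract ((N : ℝ) / (1 - y))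
    rw [hfl] at this
    push_cast at this
    linarith

lemma renyiBranch_one (N k : ℕ) : renyiBranch N k 1 = renyiBranch N (k + 1) 0 := by
  unfold renyiBranch
  congr 2
  push_cast
  ring

lemma monotone_renyiBranch_zero (hN : 2 ≤ N) : Monotone fun k => renyiBranch N k 0 :=
  monotone_nat_of_le_succ fun k => by
    rw [← renyiBranch_one]
    exact renyiBranch_mono hN k le_rfl zero_le_one

lemma pairwise_disjoint_Ioc_renyiBranch (hN : 2 ≤ N) {x : ℝ} (hx : x ∈ Icc (0 : ℝ) 1) :
    Pairwise (Function.onFun Disjoint fun k => Ioc (renyiBranch N k 0) (renyiBranch N k x)) := by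
  refine (monotone_renyiBranch_zero hN).pairwise_disjoint_on_Ioc_succ.mono fun i j h => ?_
  refine h.mono ?_ ?_ <;>
  · refine Ioc_subset_Ioc_right ?_
    rw [Nat.succ_eq_succ, Nat.succ_eq_add_one, ← renyiBranch_one]
    exact renyiBranch_mono hN _ hx.1 hx.2

lemma map_renyiMap_real_Iic (hN : 2 ≤ N) (ν : Measure ℝ) [IsProbabilityMeasure ν]
    [NullSingletonClass ν] (hν : ν (Icc (0 : ℝ) 1)ᶜ = 0) {x : ℝ} (hx : x ∈ Icc (0 : ℝ) 1) :
    (ν.map (renyiMap N)).real (Iic x)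
      = ∑' k, ν.real (Ioc (renyiBranch N k 0) (renyiBranch N k x)) := by
  have hae : (renyiMap N ⁻¹' Iic x : Set ℝ)
      =ᵐ[ν] ⋃ k, Ioc (renyiBranch N k 0) (renyiBranch N k x) := by
    have h1 : ∀ᵐ y ∂ν, y ∈ Icc (0 : ℝ) 1 := by
      rw [ae_iff]; exact hν
    have h2 : ∀ᵐ y ∂ν, y ∉ insert 1 (range fun k => renyiBranch N k 0) :=
      measure_eq_zero_iff_ae_notMem.1
        (((countable_range fun k => renyiBranch N k 0).insert 1).measure_zero ν)
    filter_upwards [h1, h2] with y hy hy2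
    have hy1 : y ≠ 1 := fun h => hy2 (Or.inl h)
    have hyb : ∀ k, y ≠ renyiBranch N k 0 := fun k h => hy2 (Or.inr ⟨k, h.symm⟩)
    apply propext
    change renyiMap N y ≤ x ↔ y ∈ ⋃ k, Ioc (renyiBranch N k 0) (renyiBranch N k x)
    rw [mem_iUnion]
    exact renyiMap_le_iff hN hx hy hy1 hyb
  rw [measureReal_def, Measure.map_apply (measurable_renyiMap N) measurableSet_Iic,
    measure_congr hae, measure_iUnion (pairwise_disjoint_Ioc_renyiBranch hN hx)
      (fun _ => measurableSet_Ioc), ENNReal.tsum_toReal_eq fun _ => measure_ne_top _ _]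
  rfl

lemma continuousOn_of_lipschitz_Icc {f : ℝ → ℝ} {L : ℝ} (hL : 0 ≤ L)
    (hf : ∀ x ∈ Icc (0 : ℝ) 1, ∀ y ∈ Icc (0 : ℝ) 1, |f x - f y| ≤ L * |x - y|) :
    ContinuousOn f (Icc 0 1) :=
  (LipschitzOnWith.of_dist_le_mul (K := ⟨L, hL⟩) fun x hx y hy => hf x hx y hy).continuousOn

lemma continuousOn_div_density (hN : 2 ≤ N) {f : ℝ → ℝ} (hf : ContinuousOn f (Icc 0 1)) :
    ContinuousOn (fun t => f t / (t + N - 1)) (Icc 0 1) := by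
  have hN' : (2 : ℝ) ≤ N := by exact_mod_cast hN
  exact hf.div (by fun_prop) fun t ht => by linarith [ht.1]

lemma hasDerivAt_renyiBranch (hN : 2 ≤ N) (k : ℕ) {x : ℝ} (hx : 0 ≤ x) :
    HasDerivAt (renyiBranch N k) (N / (x + N + k) ^ 2) x := by
  have hk : (0 : ℝ) ≤ k := k.cast_nonneg
  have hN' : (2 : ℝ) ≤ N := by exact_mod_cast hN
  have h1 : x + N + k ≠ 0 := by linarith
  have h := ((((hasDerivAt_id x).add_const (N : ℝ)).add_const (k : ℝ)).fun_inv h1).const_mul (N : ℝ)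
  have h2 := h.const_sub 1
  refine (h2.congr_deriv ?_).congr_of_eventuallyEq (Eventually.of_forall fun y => ?_)
  · simp [div_eq_mul_inv]
  · simp [renyiBranch, div_eq_mul_inv]

lemma continuousOn_renyiBranch (hN : 2 ≤ N) (k : ℕ) :
    ContinuousOn (renyiBranch N k) (Icc 0 1) := fun _ hx =>
  (hasDerivAt_renyiBranch hN k hx.1).continuousAt.continuousWithinAt

lemma integral_renyiBranch (hN : 2 ≤ N) (f : ℝ → ℝ) (k : ℕ) {x : ℝ} (hx : x ∈ Icc (0 : ℝ) 1) :
    ∫ s in renyiBranch N k 0..renyiBranch N k x, f s / (s + N - 1)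
      = ∫ t in 0..x, renyiWeight N k t * f (renyiBranch N k t) / (t + N - 1) := by
  have hk : (0 : ℝ) ≤ k := k.cast_nonneg
  have hN' : (2 : ℝ) ≤ N := by exact_mod_cast hN
  have huI : uIcc 0 x = Icc 0 x := uIcc_of_le hx.1
  rw [← intervalIntegral.integral_comp_mul_deriv_of_deriv_nonneg
    (f := renyiBranch N k) (f' := fun t => N / (t + N + k) ^ 2)]
  · refine intervalIntegral.integral_congr fun t ht => ?_
    rw [huI] at ht
    have h1 : t + N - 1 ≠ 0 := by linarith [ht.1]
    have h2 : t + N + k ≠ 0 := by linarith [ht.1]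
    have h3 : t + N + k - 1 ≠ 0 := by linarith [ht.1]
    have h4 : renyiBranch N k t + N - 1 = N * (t + N + k - 1) / (t + N + k) := by
      unfold renyiBranch; field_simp; ring
    simp only [Function.comp, h4, renyiWeight]
    field_simp
  · rw [huI]
    exact (continuousOn_renyiBranch hN k).mono (Icc_subset_Icc_right hx.2)
  · rw [min_eq_left hx.1]
    exact fun t ht => hasDerivAt_renyiBranch hN k ht.1.le
  · intro t _
    positivity

lemma continuousOn_renyiWeight (hN : 2 ≤ N) (k : ℕ) : ContinuousOn (renyiWeight N k) (Icc 0 1) := by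
  have hk : (0 : ℝ) ≤ k := k.cast_nonneg
  have hN' : (2 : ℝ) ≤ N := by exact_mod_cast hN
  refine ContinuousOn.div (by fun_prop) (by fun_prop) fun t ht => ?_
  have := ht.1
  exact mul_ne_zero (by linarith) (by linarith)

lemma hasSum_integral_renyiTransfer (hN : 2 ≤ N) {f : ℝ → ℝ} (hf : ContinuousOn f (Icc 0 1))
    {M : ℝ} (hM : ∀ x ∈ Icc (0 : ℝ) 1, |f x| ≤ M) {x : ℝ} (hx : x ∈ Icc (0 : ℝ) 1) :
    HasSum (fun k => ∫ t in 0..x, renyiWeight N k t * f (renyiBranch N k t) / (t + N - 1))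
      (∫ t in 0..x, renyiTransfer N f t / (t + N - 1)) := by
  have hN' : (2 : ℝ) ≤ N := by exact_mod_cast hN
  have hsub : uIoc 0 x ⊆ Icc (0 : ℝ) 1 := by
    rw [uIoc_of_le hx.1]
    exact fun t ht => ⟨ht.1.le, ht.2.trans hx.2⟩
  refine intervalIntegral.hasSum_integral_of_dominated_convergence
    (fun k _ => 1 / ((k : ℝ) + 1) ^ 2 * M) (fun k => ?_) (fun k => ?_) ?_ ?_ ?_
  · have hc : ContinuousOn (fun t => renyiWeight N k t * f (renyiBranch N k t)) (Icc 0 1) :=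
      (continuousOn_renyiWeight hN k).mul
        (hf.comp (continuousOn_renyiBranch hN k) fun t ht => renyiBranch_mem k ht)
    exact ((continuousOn_div_density hN hc).mono hsub).aestronglyMeasurable measurableSet_uIoc
  · refine Eventually.of_forall fun t ht => ?_
    have ht' := hsub ht
    have hpos : 0 < t + N - 1 := by linarith [ht'.1]
    rw [mul_div_right_comm, Real.norm_eq_abs, abs_mul,
      abs_of_nonneg (div_nonneg (renyiWeight_nonneg hN k ht') hpos.le)]
    exact mul_le_mul (renyiWeight_div_le hN k ht') (hM _ (renyiBranch_mem k ht'))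
      (abs_nonneg _) (by positivity)
  · exact Eventually.of_forall fun t _ => summable_one_div_succ_sq.mul_right M
  · exact intervalIntegrable_const
  · exact Eventually.of_forall fun t ht =>
      (summable_renyiWeight_mul hN hM (hsub ht)).hasSum.div_const _

/-- If `f t / (t + N - 1)` is a density of `ν` on `[0, 1]`, then
`renyiTransfer N f t / (t + N - 1)` is one of its image under `renyiMap N`. -/
lemma map_renyiMap_real_Iic_eq_integral (hN : 2 ≤ N) (ν : Measure ℝ) [IsProbabilityMeasure ν]
    [NullSingletonClass ν] (hν : ν (Icc (0 : ℝ) 1)ᶜ = 0) {f : ℝ → ℝ}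
    (hf : ContinuousOn f (Icc 0 1)) {M : ℝ} (hM : ∀ x ∈ Icc (0 : ℝ) 1, |f x| ≤ M)
    (hF : ∀ x ∈ Icc (0 : ℝ) 1, ν.real (Iic x) = ∫ t in 0..x, f t / (t + N - 1))
    {x : ℝ} (hx : x ∈ Icc (0 : ℝ) 1) :
    (ν.map (renyiMap N)).real (Iic x) = ∫ t in 0..x, renyiTransfer N f t / (t + N - 1) := by
  rw [map_renyiMap_real_Iic hN ν hν hx, ← (hasSum_integral_renyiTransfer hN hf hM hx).tsum_eq]
  congr 1
  ext k
  rw [← integral_renyiBranch hN f k hx]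
  have hle := renyiBranch_mono hN k le_rfl hx.1
  have h0 := renyiBranch_mem (N := N) k (left_mem_Icc.2 zero_le_one)
  have h1 := renyiBranch_mem (N := N) k hx
  have hint : ∀ y ∈ Icc (0 : ℝ) 1,
      IntervalIntegrable (fun t => f t / (t + N - 1)) volume 0 y := fun y hy => by
    refine ContinuousOn.intervalIntegrable ?_
    rw [uIcc_of_le hy.1]
    exact (continuousOn_div_density hN hf).mono (Icc_subset_Icc_right hy.2)
  rw [← Iic_sdiff_Iic, measureReal_sdiff (Iic_subset_Iic.2 hle) measurableSet_Iic, hF _ h1, hF _ h0,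
    intervalIntegral.integral_interval_sub_left (hint _ h1) (hint _ h0)]

end Distribution

section Convergence

variable {N : ℕ}

/-- `f t / (t + N - 1)` is a density on `[0, 1]` of the diffuse probability measure `ν`, and `f`
is Lipschitz there with constant `L`. -/
structure HasRenyiDensity (N : ℕ) (ν : Measure ℝ) (f : ℝ → ℝ) (L : ℝ) : Prop where
  isProbabilityMeasure : IsProbabilityMeasure ν
  nullSingletonClass : NullSingletonClass ν
  measure_compl : ν (Icc (0 : ℝ) 1)ᶜ = 0
  nonneg : 0 ≤ L
  lipschitz : ∀ x ∈ Icc (0 : ℝ) 1, ∀ y ∈ Icc (0 : ℝ) 1, |f x - f y| ≤ L * |x - y|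
  real_Iic : ∀ x ∈ Icc (0 : ℝ) 1, ν.real (Iic x) = ∫ t in 0..x, f t / (t + N - 1)

lemma HasRenyiDensity.map (hN : 2 ≤ N) {ν : Measure ℝ} {f : ℝ → ℝ} {L : ℝ}
    (h : HasRenyiDensity N ν f L) :
    HasRenyiDensity N (ν.map (renyiMap N)) (renyiTransfer N f) (25 / 32 * L) where
  isProbabilityMeasure :=
    have := h.isProbabilityMeasure
    Measure.isProbabilityMeasure_map (measurable_renyiMap N).aemeasurable
  nullSingletonClass :=
    have := h.nullSingletonClass
    nullSingletonClass_map_renyiMap hN ν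
  measure_compl := by
    rw [Measure.map_apply (measurable_renyiMap N) measurableSet_Icc.compl]
    have : renyiMap N ⁻¹' (Icc (0 : ℝ) 1)ᶜ = ∅ :=
      eq_empty_of_forall_notMem fun y hy => hy (renyiMap_mem_Icc N y)
    rw [this, measure_empty]
  nonneg := mul_nonneg (by norm_num) h.nonneg
  lipschitz _ hx _ hy := renyiTransfer_lipschitz hN h.nonneg h.lipschitz hx hy
  real_Iic _ hx :=
    have := h.isProbabilityMeasure
    have := h.nullSingletonClass
    map_renyiMap_real_Iic_eq_integral hN ν h.measure_compl
      (continuousOn_of_lipschitz_Icc h.nonneg h.lipschitz)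
      (abs_le_of_lipschitz_Icc h.nonneg h.lipschitz) h.real_Iic hx

lemma HasRenyiDensity.map_iterate (hN : 2 ≤ N) {μ : Measure ℝ} {f : ℝ → ℝ} {L : ℝ}
    (h : HasRenyiDensity N μ f L) (n : ℕ) :
    HasRenyiDensity N (μ.map (renyiMap N)^[n]) ((renyiTransfer N)^[n] f) ((25 / 32) ^ n * L) := by
  induction n with
  | zero => simpa using h
  | succ n ih =>
    rw [Function.iterate_succ', Function.iterate_succ_apply', pow_succ', mul_assoc,
      ← Measure.map_map (measurable_renyiMap N) ((measurable_renyiMap N).iterate n)]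
    exact ih.map hN

lemma Fdist_eq_map_real (N : ℕ) {μ : Measure ℝ} (hsupp : μ (Icc (0 : ℝ) 1)ᶜ = 0) (n : ℕ)
    (x : ℝ) : Fdist N μ n x = (μ.map (renyiMap N)^[n]).real (Iic x) := by
  rw [Fdist, measureReal_def,
    Measure.map_apply ((measurable_renyiMap N).iterate n) measurableSet_Iic]
  congr 1
  refine measure_congr ?_
  have h1 : ∀ᵐ y ∂μ, y ∈ Icc (0 : ℝ) 1 := by
    rw [ae_iff]; exact hsupp
  filter_upwards [h1] with y hy
  exact propext ⟨fun h => h.2, fun h => ⟨hy, h⟩⟩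

lemma exists_hasRenyiDensity (hN : 2 ≤ N) (μ : Measure ℝ) [IsProbabilityMeasure μ]
    [NullSingletonClass μ] (hsupp : μ (Icc (0 : ℝ) 1)ᶜ = 0)
    (hsmooth : ContDiffOn ℝ 2 (Fdist N μ 0) (Icc 0 1)) :
    ∃ f L, HasRenyiDensity N μ f L := by
  have hN' : (2 : ℝ) ≤ N := by exact_mod_cast hN
  have hu : UniqueDiffOn ℝ (Icc (0 : ℝ) 1) := uniqueDiffOn_Icc zero_lt_one
  have hd : ContDiffOn ℝ 1 (derivWithin (Fdist N μ 0) (Icc 0 1)) (Icc 0 1) :=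
    hsmooth.derivWithin hu (by norm_num)
  have hg : ContDiffOn ℝ 1
      (fun t => derivWithin (Fdist N μ 0) (Icc 0 1) t * (t + N - 1)) (Icc 0 1) :=
    hd.mul (by fun_prop)
  obtain ⟨K, hK⟩ := hg.exists_lipschitzOnWith one_ne_zero (convex_Icc 0 1) isCompact_Icc
  refine ⟨_, K, inferInstance, inferInstance, hsupp, K.2, fun x hx y hy => hK.dist_le_mul x hx y hy,
    fun x hx => ?_⟩
  have hF : ∀ y, Fdist N μ 0 y = μ.real (Iic y) := fun y => by
    simpa using Fdist_eq_map_real N hsupp 0 y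
  have hF0 : Fdist N μ 0 0 = 0 := by
    have : {y ∈ Icc (0 : ℝ) 1 | (renyiMap N)^[0] y ≤ 0} = {0} := by
      ext y
      simp only [mem_ofPred_eq, mem_Icc, Function.iterate_zero, id, mem_singleton_iff]
      exact ⟨fun h => le_antisymm h.2 h.1.1, fun h => by simp [h]⟩
    rw [Fdist, this, measure_singleton, ENNReal.toReal_zero]
  have hsub : Icc 0 x ⊆ Icc (0 : ℝ) 1 := Icc_subset_Icc_right hx.2
  have hftc := intervalIntegral.integral_eq_sub_of_hasDerivAt_of_le hx.1
    (hsmooth.continuousOn.mono hsub) (f' := derivWithin (Fdist N μ 0) (Icc 0 1))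
    (fun t ht => by
      have hnhds : Icc (0 : ℝ) 1 ∈ nhds t := Icc_mem_nhds ht.1 (ht.2.trans_le hx.2)
      exact ((hsmooth.differentiableOn two_ne_zero) t
        (mem_of_mem_nhds hnhds)).hasDerivWithinAt.hasDerivAt hnhds)
    (ContinuousOn.intervalIntegrable (by
      rw [uIcc_of_le hx.1]; exact hd.continuousOn.mono hsub))
  rw [hF0, sub_zero, hF] at hftc
  rw [← hftc]
  refine intervalIntegral.integral_congr fun t ht => ?_
  rw [uIcc_of_le hx.1] at ht
  have : t + N - 1 ≠ 0 := by linarith [ht.1]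
  field_simp

lemma intervalIntegrable_one_div_density (hN : 2 ≤ N) {x : ℝ} (hx : 0 ≤ x) :
    IntervalIntegrable (fun t : ℝ => 1 / (t + N - 1)) volume 0 x := by
  have hN' : (2 : ℝ) ≤ N := by exact_mod_cast hN
  refine ContinuousOn.intervalIntegrable ?_
  rw [uIcc_of_le hx]
  exact continuousOn_const.div (by fun_prop) fun t ht => by linarith [ht.1]

lemma integral_one_div_density (hN : 2 ≤ N) :
    ∫ t in (0 : ℝ)..1, 1 / (t + N - 1) = Real.log (N / (N - 1)) := by
  have hN' : (2 : ℝ) ≤ N := by exact_mod_cast hN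
  have h := intervalIntegral.integral_comp_add_right (a := 0) (b := 1)
    (fun t : ℝ => t⁻¹) ((N : ℝ) - 1)
  rw [integral_inv_of_pos (by linarith) (by linarith)] at h
  simp only [zero_add, add_sub_cancel] at h
  rw [← h]
  refine intervalIntegral.integral_congr fun t _ => ?_
  simp only [one_div, add_sub_assoc]

lemma HasRenyiDensity.abs_real_Iic_sub_le (hN : 2 ≤ N) {ν : Measure ℝ} {f : ℝ → ℝ} {L : ℝ}
    (h : HasRenyiDensity N ν f L) {x : ℝ} (hx : x ∈ Icc (0 : ℝ) 1) :
    |ν.real (Iic x) - f 0 * ∫ t in 0..x, 1 / (t + N - 1)| ≤ L := by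
  have hN' : (2 : ℝ) ≤ N := by exact_mod_cast hN
  have hcont := continuousOn_of_lipschitz_Icc h.nonneg h.lipschitz
  have hint : IntervalIntegrable (fun t => f t / (t + N - 1)) volume 0 x := by
    refine ContinuousOn.intervalIntegrable ?_
    rw [uIcc_of_le hx.1]
    exact (continuousOn_div_density hN hcont).mono (Icc_subset_Icc_right hx.2)
  rw [h.real_Iic x hx, ← intervalIntegral.integral_const_mul, ← intervalIntegral.integral_sub hint
    ((intervalIntegrable_one_div_density hN hx.1).const_mul _), ← Real.norm_eq_abs]
  refine (intervalIntegral.norm_integral_le_of_norm_le_const (C := L) fun t ht => ?_).trans ?_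
  · rw [uIoc_of_le hx.1] at ht
    have ht' : t ∈ Icc (0 : ℝ) 1 := ⟨ht.1.le, ht.2.trans hx.2⟩
    have hpos : 0 < t + N - 1 := by linarith [ht'.1]
    have hl := h.lipschitz t ht' 0 (left_mem_Icc.2 zero_le_one)
    rw [sub_zero, abs_of_nonneg ht'.1] at hl
    rw [mul_one_div, ← sub_div, Real.norm_eq_abs, abs_div, abs_of_pos hpos, div_le_iff₀ hpos]
    exact hl.trans (mul_le_mul_of_nonneg_left (by linarith) h.nonneg)
  · rw [sub_zero, abs_of_nonneg hx.1]
    exact mul_le_of_le_one_right h.nonneg hx.2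

lemma HasRenyiDensity.real_Iic_one {ν : Measure ℝ} {f : ℝ → ℝ} {L : ℝ}
    (h : HasRenyiDensity N ν f L) : ν.real (Iic 1) = 1 := by
  have := h.isProbabilityMeasure
  have h0 : ν (Iic (1 : ℝ))ᶜ = 0 :=
    measure_mono_null (compl_subset_compl.2 Icc_subset_Iic_self) h.measure_compl
  rw [measureReal_def, (prob_compl_eq_zero_iff measurableSet_Iic).1 h0, ENNReal.toReal_one]

lemma HasRenyiDensity.abs_mul_log_sub_le (hN : 2 ≤ N) {ν : Measure ℝ} {f : ℝ → ℝ} {L : ℝ}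
    (h : HasRenyiDensity N ν f L) {x : ℝ} (hx : x ∈ Icc (0 : ℝ) 1) :
    |ν.real (Iic x) * Real.log (N / (N - 1)) - ∫ t in 0..x, 1 / (t + N - 1)|
      ≤ L * (|Real.log (N / (N - 1))| + |∫ t in 0..x, 1 / (t + N - 1)|) := by
  have h1 := h.abs_real_Iic_sub_le hN hx
  have h2 := h.abs_real_Iic_sub_le hN (right_mem_Icc.2 zero_le_one)
  rw [h.real_Iic_one, integral_one_div_density hN] at h2
  set l := Real.log (N / (N - 1))
  set G := ∫ t in 0..x, 1 / (t + N - 1)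
  have e : ν.real (Iic x) * l - G = (ν.real (Iic x) - f 0 * G) * l - G * (1 - f 0 * l) := by ring
  rw [e]
  refine (abs_sub _ _).trans ?_
  rw [abs_mul, abs_mul, mul_add, mul_comm |G|]
  gcongr

end Convergence

/-- `F_{N,n}(x) → ρ_N([0,x])`, where `ρ_N` has density
`1/(log(N/(N-1)) (x+N-1))` with respect to Lebesgue measure on `[0,1]`. -/
theorem Fdist_tendsto_invariant (N : ℕ) (hN : 2 ≤ N) (μ : Measure ℝ)
    [IsProbabilityMeasure μ] [NullSingletonClass μ] (hsupp : μ (Icc (0 : ℝ) 1)ᶜ = 0)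
    (hsmooth : ContDiffOn ℝ 2 (Fdist N μ 0) (Icc 0 1)) :
    ∀ x ∈ Icc (0 : ℝ) 1,
      Tendsto (fun n => Fdist N μ n x) atTop
        (nhds (∫ t in Icc (0 : ℝ) x, 1 / (Real.log ((N : ℝ) / (N - 1)) * (t + N - 1)))) := by
  intro x hx
  have hN' : (2 : ℝ) ≤ N := by exact_mod_cast hN
  obtain ⟨f, L, h⟩ := exists_hasRenyiDensity hN μ hsupp hsmooth
  have hl : Real.log ((N : ℝ) / (N - 1)) ≠ 0 := by
    refine (Real.log_pos ?_).ne'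
    rw [one_lt_div (by linarith)]
    linarith
  have hlim : ∫ t in Icc (0 : ℝ) x, 1 / (Real.log ((N : ℝ) / (N - 1)) * (t + N - 1))
      = (∫ t in 0..x, 1 / (t + N - 1)) / Real.log ((N : ℝ) / (N - 1)) := by
    rw [integral_Icc_eq_integral_Ioc, ← intervalIntegral.integral_of_le hx.1,
      ← intervalIntegral.integral_div]
    simp only [div_div, mul_comm]
  rw [hlim]
  have hpow : Tendsto (fun n : ℕ => (25 / 32 : ℝ) ^ n) atTop (nhds 0) :=
    tendsto_pow_atTop_nhds_zero_of_lt_one (by norm_num) (by norm_num)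
  have hbound : Tendsto (fun n : ℕ => (25 / 32 : ℝ) ^ n * L
      * (|Real.log (N / (N - 1))| + |∫ t in 0..x, 1 / (t + N - 1)|)) atTop (nhds 0) := by
    simpa using (hpow.mul_const L).mul_const
      (|Real.log (N / (N - 1))| + |∫ t in 0..x, 1 / (t + N - 1)|)
  have hdiff : Tendsto (fun n => (μ.map (renyiMap N)^[n]).real (Iic x) * Real.log (N / (N - 1))
      - ∫ t in 0..x, 1 / (t + N - 1)) atTop (nhds 0) := squeeze_zero_norm
    (fun n => (h.map_iterate hN n).abs_mul_log_sub_le hN hx) hbound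
  have hF := (tendsto_sub_nhds_zero_iff.1 hdiff).div_const (Real.log ((N : ℝ) / (N - 1)))
  refine hF.congr fun n => ?_
  rw [mul_div_cancel_right₀ _ hl, Fdist_eq_map_real N hsupp]
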